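/- A root oscillates by less than one on a facet: for any facet σ, any r ∈ R, and any two points p, p' ∈ σ, one has |r(p) − r(p')| < 1. -/

import Mathlib

open Set

/-- The set of affine roots `(r, n)` with `r ∈ R`, `n : ℤ`, vanishing at the point `x`,
i.e. such that `r x + n = 0`.  This is the set `Y_x`. -/
def affineRootsVanishingAt {V : Type*} [NormedAddCommGroup V] [NormedSpace ℝ V]
    (R : Finset (V →ₗ[ℝ] ℝ)) (x : V) : Set ((V →ₗ[ℝ] ℝ) × ℤ) :=
  {α | α.1 ∈ R ∧ α.1 x + (α.2 : ℝ) = 0}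

/-- `H_n`: the set of points where exactly `n` affine roots vanish. -/
def Hset {V : Type*} [NormedAddCommGroup V] [NormedSpace ℝ V]
    (R : Finset (V →ₗ[ℝ] ℝ)) (n : ℕ) : Set V :=
  {x | (affineRootsVanishingAt R x).ncard = n}

/-- A facet is a connected component of some `H_n`. -/
def IsFacet {V : Type*} [NormedAddCommGroup V] [NormedSpace ℝ V]
    (R : Finset (V →ₗ[ℝ] ℝ)) (σ : Set V) : Prop :=
  ∃ (n : ℕ) (x : V), x ∈ Hset R n ∧ σ = connectedComponentIn (Hset R n) x

open Topology in
theorem eventually_int_add_eq_zero_imp (a : ℝ) :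
    ∀ᶠ t : ℝ in 𝓝 a, ∀ n : ℤ, t + n = 0 → a + n = 0 := by
  have h₁ : (⌈a⌉ : ℝ) - 1 < a := by linarith [Int.ceil_lt_add_one a]
  have h₂ : a < (⌊a⌋ : ℝ) + 1 := Int.lt_floor_add_one a
  filter_upwards [Ioo_mem_nhds h₁ h₂] with t ht n hn
  have hlow : ⌈a⌉ - 1 < -n := by
    have : ((⌈a⌉ - 1 : ℤ) : ℝ) < ((-n : ℤ) : ℝ) := by push_cast; linarith [ht.1]
    exact_mod_cast this
  have hupp : -n < ⌊a⌋ + 1 := by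
    have : ((-n : ℤ) : ℝ) < ((⌊a⌋ + 1 : ℤ) : ℝ) := by push_cast; linarith [ht.2]
    exact_mod_cast this
  have hle : a ≤ ((-n : ℤ) : ℝ) := Int.ceil_le.mp (by omega)
  have hge : ((-n : ℤ) : ℝ) ≤ a := Int.le_floor.mp (by omega)
  push_cast at hle hge
  linarith

section Facets

variable {V : Type*} [NormedAddCommGroup V] [NormedSpace ℝ V]

theorem finite_affineRootsVanishingAt (R : Finset (V →ₗ[ℝ] ℝ)) (x : V) :
    (affineRootsVanishingAt R x).Finite := by
  refine Set.Finite.of_finite_image (f := Prod.fst) (R.finite_toSet.subset ?_) ?_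
  · rintro _ ⟨α, hα, rfl⟩
    exact hα.1
  · rintro ⟨r, m⟩ ⟨-, hm⟩ ⟨s, n⟩ ⟨-, hn⟩ (rfl : r = s)
    have : (m : ℝ) = n := by
      dsimp only at hm hn
      linarith
    rw [Int.cast_injective this]

variable [FiniteDimensional ℝ V]

open Topology in
theorem eventually_affineRootsVanishingAt_subset (R : Finset (V →ₗ[ℝ] ℝ)) (x : V) :
    ∀ᶠ y in 𝓝 x, affineRootsVanishingAt R y ⊆ affineRootsVanishingAt R x := by
  have h : ∀ᶠ y in 𝓝 x, ∀ r ∈ R, ∀ n : ℤ, r y + n = 0 → r x + n = 0 := by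
    rw [Filter.eventually_all_finset]
    intro r _
    exact r.continuous_of_finiteDimensional.continuousAt.eventually
      (eventually_int_add_eq_zero_imp (r x))
  filter_upwards [h] with y hy α hα
  exact ⟨hα.1, hy α.1 hα.1 α.2 hα.2⟩

theorem affineRootsVanishingAt_eq_of_isPreconnected (R : Finset (V →ₗ[ℝ] ℝ)) {n : ℕ}
    {σ : Set V} (hσ : IsPreconnected σ) (hσn : σ ⊆ Hset R n) {p q : V} (hp : p ∈ σ)
    (hq : q ∈ σ) : affineRootsVanishingAt R p = affineRootsVanishingAt R q := by
  have hloc : IsLocallyConstant fun x : σ => affineRootsVanishingAt R (x : V) := by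
    rw [IsLocallyConstant.iff_eventually_eq]
    intro x
    filter_upwards [continuous_subtype_val.continuousAt.eventually
      (eventually_affineRootsVanishingAt_subset R (x : V))] with y hy
    refine Set.eq_of_subset_of_ncard_le hy ?_ (finite_affineRootsVanishingAt R _)
    exact ((hσn x.2).trans (hσn y.2).symm).le
  have := isPreconnected_iff_preconnectedSpace.mp hσ
  exact hloc.apply_eq_of_preconnectedSpace ⟨p, hp⟩ ⟨q, hq⟩

theorem root_sub_lt_one_of_isPreconnected (R : Finset (V →ₗ[ℝ] ℝ)) {n : ℕ}
    {σ : Set V} (hσ : IsPreconnected σ) (hσn : σ ⊆ Hset R n) {r : V →ₗ[ℝ] ℝ} (hr : r ∈ R)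
    {p q : V} (hp : p ∈ σ) (hq : q ∈ σ) : r q - r p < 1 := by
  by_contra! h
  obtain ⟨z, hz, hrz⟩ := hσ.intermediate_value hp hq
    r.continuous_of_finiteDimensional.continuousOn
    (show (⌈r p⌉ : ℝ) ∈ Set.Icc (r p) (r q) from
      ⟨Int.le_ceil _, by linarith [Int.ceil_lt_add_one (r p)]⟩)
  have hmem : (r, -⌈r p⌉) ∈ affineRootsVanishingAt R z := ⟨hr, by simp [hrz]⟩
  have hmp := hmem
  rw [affineRootsVanishingAt_eq_of_isPreconnected R hσ hσn hz hp] at hmp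
  rw [affineRootsVanishingAt_eq_of_isPreconnected R hσ hσn hz hq] at hmem
  have h₁ := hmp.2
  have h₂ := hmem.2
  dsimp only at h₁ h₂
  linarith

end Facets

theorem root_oscillation_lt_one_on_facet {V : Type*} [NormedAddCommGroup V] [NormedSpace ℝ V] [FiniteDimensional ℝ V]
    (R : Finset (V →ₗ[ℝ] ℝ)) (hR : ∀ r ∈ R, r ≠ 0)
    (σ : Set V) (hσ : IsFacet R σ) (r : V →ₗ[ℝ] ℝ) (hr : r ∈ R) :
    ∀ p ∈ σ, ∀ p' ∈ σ, |r p - r p'| < 1 := by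
  obtain ⟨n, x, -, rfl⟩ := hσ
  intro p hp p' hp'
  have hc := isPreconnected_connectedComponentIn (F := Hset R n) (x := x)
  have hs := connectedComponentIn_subset (Hset R n) x
  have h₁ := root_sub_lt_one_of_isPreconnected R hc hs hr hp hp'
  have h₂ := root_sub_lt_one_of_isPreconnected R hc hs hr hp' hp
  exact abs_lt.mpr ⟨by linarith, h₂⟩
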